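/- Under the decay condition (D) with parameter θ ∈ (0,1/2) and for weighting vectors v_n, w_n with finite ℓ1-norms, there is a constant C such that for all n, n' ≥ 1: (1) Σ_{i=1}^∞ Σ_{ℓ=0}^∞ (f̃_{ℓ,i}(𝔞,v_n,w_n) − f̃_{ℓ,i+n'}(𝔞,v_n,w_n))² ≤ C‖v_n‖_{ℓ1}²‖w_n‖_{ℓ1}²·(n')^{1−θ}; (2) Σ_{k=1}^{n'} Σ_{r=0}^∞ f̃_{r+k,0}(𝔞,v_n,w_n)² ≤ C‖v_n‖_{ℓ1}²‖w_n‖_{ℓ1}²·(n')^{1−θ}; (3) Σ_{k=1}^{n'} Σ_{ℓ=0}^∞ f̃_{ℓ,k}(𝔞,v_n,w_n)² ≤ C‖v_n‖_{ℓ1}²‖w_n‖_{ℓ1}²·(n')^{1−θ}. The constant C does not depend on the coefficient array 𝔞. -/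

import Mathlib

noncomputable section

/-- The coefficients `f_{ℓ,j}(𝔞, v, w)`. -/
def fCoef (d : ℕ) (a : ℕ → ℕ → ℝ) (v w : ℕ → ℝ) (ℓ j : ℕ) : ℝ :=
  if ℓ = 0 then
    ∑ ν ∈ Finset.range d, ∑ μ ∈ Finset.range d, v ν * w μ * (a j ν * a j μ)
  else
    ∑ ν ∈ Finset.range d, ∑ μ ∈ Finset.range d,
      v ν * w μ * (a j ν * a (j + ℓ) μ + a j μ * a (j + ℓ) ν)

/-- `f̃_{ℓ,i}(𝔞, v, w) = Σ_{j ≥ i} f_{ℓ,j}(𝔞, v, w)`. -/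
def fTilde (d : ℕ) (a : ℕ → ℕ → ℝ) (v w : ℕ → ℝ) (ℓ i : ℕ) : ℝ :=
  ∑' j : ℕ, fCoef d a v w ℓ (i + j)

/-- The ℓ¹-norm of a weighting vector in `ℝ^d`. -/
def l1norm (d : ℕ) (v : ℕ → ℝ) : ℝ := ∑ ν ∈ Finset.range d, |v ν|

/-- A power of `X` is dominated by products of powers of smaller quantities. -/
lemma rpow_neg_add_le_mul {X x y a b : ℝ} (hx : 0 < x) (hy : 0 < y) (hxX : x ≤ X) (hyX : y ≤ X)
    (ha : 0 ≤ a) (hb : 0 ≤ b) : X ^ (-(a + b)) ≤ x ^ (-a) * y ^ (-b) := by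
  have hX : 0 < X := hx.trans_le hxX
  rw [neg_add, Real.rpow_add hX]
  have h1 : X ^ (-a) ≤ x ^ (-a) := Real.rpow_le_rpow_of_nonpos hx hxX (by linarith)
  have h2 : X ^ (-b) ≤ y ^ (-b) := Real.rpow_le_rpow_of_nonpos hy hyX (by linarith)
  gcongr

lemma summable_succ_rpow_neg {p : ℝ} (hp : 1 < p) :
    Summable fun j : ℕ => ((j : ℝ) + 1) ^ (-p) := by
  have h := (summable_nat_add_iff 1).2 (Real.summable_nat_rpow.2 (by linarith : -p < -1))
  simpa using h

lemma tsum_le_mul_tsum {x y : ℕ → ℝ} {c : ℝ} (hx : ∀ i, 0 ≤ x i) (hxy : ∀ i, x i ≤ c * y i)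
    (hy : Summable y) : ∑' i, x i ≤ c * ∑' i, y i := by
  rw [← tsum_mul_left]
  have h := hy.mul_left c
  exact (Summable.of_nonneg_of_le hx hxy h).tsum_le_tsum hxy h

lemma sum_range_succ_rpow_neg_le {p : ℝ} (hp0 : 0 ≤ p) (hp1 : p < 1) (n : ℕ) :
    ∑ t ∈ Finset.range n, ((t : ℝ) + 1) ^ (-p) ≤ (n : ℝ) ^ (1 - p) / (1 - p) := by
  have hp : 0 < 1 - p := by linarith
  induction n with
  | zero => simp [Real.zero_rpow hp.ne']
  | succ n ih =>
    rw [Finset.sum_range_succ]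
    have hn : (0 : ℝ) < (n : ℝ) + 1 := by positivity
    have hB := rpow_one_add_le_one_add_mul_self
      (s := -(1 / ((n : ℝ) + 1))) (p := 1 - p)
      (by rw [neg_le_neg_iff, div_le_one hn]; simp) hp.le (by linarith)
    have hq : 1 + -(1 / ((n : ℝ) + 1)) = n / (n + 1) := by field_simp; ring
    rw [hq, Real.div_rpow (by positivity) hn.le, div_le_iff₀ (by positivity)] at hB
    have hs : ((n : ℝ) + 1) ^ (1 - p) = ((n : ℝ) + 1) * ((n : ℝ) + 1) ^ (-p) := by
      rw [sub_eq_add_neg, Real.rpow_add hn, Real.rpow_one]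
    have hB' : (n : ℝ) ^ (1 - p) ≤
        ((n : ℝ) + 1) ^ (1 - p) - (1 - p) * ((n : ℝ) + 1) ^ (-p) := by
      refine hB.trans (le_of_eq ?_)
      rw [hs]
      field_simp
      ring
    push_cast
    rw [le_div_iff₀ hp] at ih ⊢
    linarith

/-- The decaying sequence `(j + 1)^{-3/4 - θ/2}`. -/
def decaySeq (θ : ℝ) (j : ℕ) : ℝ := ((j : ℝ) + 1) ^ (-(3 / 4 + θ / 2))

lemma decaySeq_nonneg (θ : ℝ) (j : ℕ) : 0 ≤ decaySeq θ j := by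
  unfold decaySeq; positivity

lemma decaySeq_anti {θ : ℝ} (hθ : 0 < θ) {i j : ℕ} (h : i ≤ j) : decaySeq θ j ≤ decaySeq θ i := by
  unfold decaySeq
  have : (i : ℝ) ≤ j := by exact_mod_cast h
  exact Real.rpow_le_rpow_of_nonpos (by positivity) (by linarith) (by linarith)

lemma decaySeq_mul_add_le {θ : ℝ} (hθ0 : 0 < θ) (hθ1 : θ < 1 / 2) (j r : ℕ) {k : ℕ} (hk : 1 ≤ k) :
    decaySeq θ j * decaySeq θ (j + r + k) ≤
      (k : ℝ) ^ (-(θ / 2)) * ((r : ℝ) + 1) ^ (-(1 / 2 + θ / 4)) *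
        ((j : ℝ) + 1) ^ (-(1 + θ / 4)) := by
  have hk' : (1 : ℝ) ≤ k := by exact_mod_cast hk
  have hj0 : (0 : ℝ) ≤ j := by positivity
  have hr0 : (0 : ℝ) ≤ r := by positivity
  set X : ℝ := ((j + r + k : ℕ) : ℝ) + 1 with hX
  have hX' : X = j + r + k + 1 := by rw [hX]; push_cast; ring
  have h1 := rpow_neg_add_le_mul (X := X) (x := k) (y := (r : ℝ) + 1) (a := θ / 2)
    (b := 1 / 2 + θ / 4) (by linarith) (by linarith) (by linarith) (by linarith)
    (by linarith) (by linarith)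
  have h2 : X ^ (-(1 / 4 - θ / 4)) ≤ ((j : ℝ) + 1) ^ (-(1 / 4 - θ / 4)) :=
    Real.rpow_le_rpow_of_nonpos (by linarith) (by linarith) (by linarith)
  have hXpos : 0 < X := by linarith
  have e1 : decaySeq θ (j + r + k) =
      X ^ (-(θ / 2 + (1 / 2 + θ / 4))) * X ^ (-(1 / 4 - θ / 4)) := by
    rw [← Real.rpow_add hXpos, decaySeq, ← hX]; congr 1; ring
  have e2 : ((j : ℝ) + 1) ^ (-(1 + θ / 4)) =
      decaySeq θ j * ((j : ℝ) + 1) ^ (-(1 / 4 - θ / 4)) := by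
    rw [decaySeq, ← Real.rpow_add (by positivity)]; congr 1; ring
  rw [e1, e2]
  calc decaySeq θ j * (X ^ (-(θ / 2 + (1 / 2 + θ / 4))) * X ^ (-(1 / 4 - θ / 4)))
      ≤ decaySeq θ j * (((k : ℝ) ^ (-(θ / 2)) * ((r : ℝ) + 1) ^ (-(1 / 2 + θ / 4))) *
          ((j : ℝ) + 1) ^ (-(1 / 4 - θ / 4))) := by
        have := decaySeq_nonneg θ j
        gcongr
    _ = _ := by ring

lemma decaySeq_window_le {θ : ℝ} (hθ0 : 0 < θ) (i t ℓ : ℕ) :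
    decaySeq θ (i + t) * decaySeq θ (i + t + ℓ) ≤
      ((i : ℝ) + 1) ^ (-(1 / 2 + θ / 4)) * ((ℓ : ℝ) + 1) ^ (-(1 / 2 + θ / 4)) *
        ((t : ℝ) + 1) ^ (-((1 + θ) / 2)) := by
  have hi0 : (0 : ℝ) ≤ i := by positivity
  have ht0 : (0 : ℝ) ≤ t := by positivity
  have hl0 : (0 : ℝ) ≤ ℓ := by positivity
  set Y : ℝ := ((i + t : ℕ) : ℝ) + 1 with hY
  have hY' : Y = i + t + 1 := by rw [hY]; push_cast; ring
  have hYpos : 0 < Y := by linarith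
  have h1 := rpow_neg_add_le_mul (X := ((i + t + ℓ : ℕ) : ℝ) + 1) (x := (ℓ : ℝ) + 1) (y := Y)
    (a := 1 / 2 + θ / 4) (b := 1 / 4 + θ / 4) (by linarith) hYpos (by push_cast; linarith)
    (by push_cast; linarith) (by linarith) (by linarith)
  have h2 := rpow_neg_add_le_mul (X := Y) (x := (i : ℝ) + 1) (y := (t : ℝ) + 1)
    (a := 1 / 2 + θ / 4) (b := (1 + θ) / 2) (by linarith) (by linarith) (by linarith)
    (by linarith) (by linarith) (by linarith)
  have e1 : decaySeq θ (i + t) * Y ^ (-(1 / 4 + θ / 4)) =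
      Y ^ (-(1 / 2 + θ / 4 + (1 + θ) / 2)) := by
    rw [decaySeq, ← hY, ← Real.rpow_add hYpos]; congr 1; ring
  have e2 : decaySeq θ (i + t + ℓ) =
      (((i + t + ℓ : ℕ) : ℝ) + 1) ^ (-(1 / 2 + θ / 4 + (1 / 4 + θ / 4))) := by
    rw [decaySeq]; congr 1; ring
  rw [← e2] at h1
  calc decaySeq θ (i + t) * decaySeq θ (i + t + ℓ)
      ≤ decaySeq θ (i + t) * (((ℓ : ℝ) + 1) ^ (-(1 / 2 + θ / 4)) * Y ^ (-(1 / 4 + θ / 4))) := by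
        have := decaySeq_nonneg θ (i + t)
        gcongr
    _ = ((ℓ : ℝ) + 1) ^ (-(1 / 2 + θ / 4)) * Y ^ (-(1 / 2 + θ / 4 + (1 + θ) / 2)) := by
        rw [← e1]; ring
    _ ≤ ((ℓ : ℝ) + 1) ^ (-(1 / 2 + θ / 4)) *
          (((i : ℝ) + 1) ^ (-(1 / 2 + θ / 4)) * ((t : ℝ) + 1) ^ (-((1 + θ) / 2))) := by
        gcongr
    _ = _ := by ring

lemma rpow_sq_of_pos {x : ℝ} (hx : 0 < x) {p q : ℝ} (h : 2 * p = q) : (x ^ p) ^ 2 = x ^ q := by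
  rw [pow_two, ← Real.rpow_add hx, ← h]; congr 1; ring

/-- The sum `∑ (j + 1)^{-p}` over all `j`. -/
def zetaSum (p : ℝ) : ℝ := ∑' j : ℕ, ((j : ℝ) + 1) ^ (-p)

lemma zetaSum_nonneg (p : ℝ) : 0 ≤ zetaSum p := tsum_nonneg fun j => by positivity

/-- A square-sum bound for series whose terms are dominated by products of the decaying sequence. -/
lemma sum_tsum_sq_tail_le {θ A : ℝ} (hθ0 : 0 < θ) (hθ1 : θ < 1 / 2) (hA : 0 ≤ A)
    {u : ℕ → ℕ → ℕ → ℝ}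
    (hu : ∀ k r j, |u k r j| ≤ A * (decaySeq θ j * decaySeq θ (j + r + k))) (n : ℕ) :
    ∑ k ∈ Finset.Icc 1 n, ∑' r : ℕ, (∑' j : ℕ, u k r j) ^ 2 ≤
      A ^ 2 * (zetaSum (1 + θ / 4) ^ 2 * zetaSum (1 + θ / 2) / (1 - θ)) *
        (n : ℝ) ^ (1 - θ) := by
  set Z := zetaSum (1 + θ / 4)
  have hZ0 : 0 ≤ Z := zetaSum_nonneg _
  have hY0 := zetaSum_nonneg (1 + θ / 2)
  have hinner : ∀ k, 1 ≤ k → ∀ r, |∑' j : ℕ, u k r j| ≤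
      A * ((k : ℝ) ^ (-(θ / 2)) * ((r : ℝ) + 1) ^ (-(1 / 2 + θ / 4))) * Z := by
    intro k hk r
    have hb : ∀ j, |u k r j| ≤
        A * ((k : ℝ) ^ (-(θ / 2)) * ((r : ℝ) + 1) ^ (-(1 / 2 + θ / 4))) *
          ((j : ℝ) + 1) ^ (-(1 + θ / 4)) := fun j => by
      rw [mul_assoc A]
      exact (hu k r j).trans
        (mul_le_mul_of_nonneg_left (decaySeq_mul_add_le hθ0 hθ1 j r hk) hA)
    have hs := summable_succ_rpow_neg (by linarith : 1 < 1 + θ / 4)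
    have hsu : Summable fun j => |u k r j| :=
      Summable.of_nonneg_of_le (fun _ => abs_nonneg _) hb (hs.mul_left _)
    have := norm_tsum_le_tsum_norm (f := u k r) hsu
    exact this.trans (tsum_le_mul_tsum (fun _ => abs_nonneg _) hb hs)
  have houter : ∀ k, 1 ≤ k → ∑' r : ℕ, (∑' j : ℕ, u k r j) ^ 2 ≤
      A ^ 2 * Z ^ 2 * (k : ℝ) ^ (-θ) * zetaSum (1 + θ / 2) := by
    intro k hk
    refine tsum_le_mul_tsum (fun _ => sq_nonneg _) (fun r => ?_)
      (summable_succ_rpow_neg (by linarith))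
    rw [← sq_abs]
    refine (pow_le_pow_left₀ (abs_nonneg _) (hinner k hk r) 2).trans (le_of_eq ?_)
    have hk' : (0 : ℝ) < k := by exact_mod_cast hk
    rw [← rpow_sq_of_pos hk' (by ring : 2 * (-(θ / 2)) = -θ),
      ← rpow_sq_of_pos (by positivity : (0 : ℝ) < (r : ℝ) + 1)
        (by ring : 2 * (-(1 / 2 + θ / 4)) = -(1 + θ / 2))]
    ring
  calc ∑ k ∈ Finset.Icc 1 n, ∑' r : ℕ, (∑' j : ℕ, u k r j) ^ 2
      ≤ ∑ k ∈ Finset.Icc 1 n, A ^ 2 * Z ^ 2 * (k : ℝ) ^ (-θ) * zetaSum (1 + θ / 2) :=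
        Finset.sum_le_sum fun k hk => houter k (Finset.mem_Icc.1 hk).1
    _ = A ^ 2 * Z ^ 2 * zetaSum (1 + θ / 2) * ∑ t ∈ Finset.range n, ((t : ℝ) + 1) ^ (-θ) := by
        rw [← Finset.Ico_add_one_right_eq_Icc, Finset.sum_Ico_eq_sum_range, Finset.mul_sum]
        refine Finset.sum_congr rfl fun t _ => ?_
        push_cast
        rw [add_comm (1 : ℝ)]
        ring
    _ ≤ A ^ 2 * Z ^ 2 * zetaSum (1 + θ / 2) * ((n : ℝ) ^ (1 - θ) / (1 - θ)) := by
        gcongr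
        exact sum_range_succ_rpow_neg_le hθ0.le (by linarith) n
    _ = _ := by ring

lemma tsum_tsum_sq_window_le {θ A : ℝ} (hθ0 : 0 < θ) (hθ1 : θ < 1 / 2) (hA : 0 ≤ A)
    {f : ℕ → ℕ → ℝ}
    (hf : ∀ ℓ j, |f ℓ j| ≤ A * (decaySeq θ j * decaySeq θ (j + ℓ))) (n : ℕ) :
    ∑' i : ℕ, ∑' ℓ : ℕ, (∑ t ∈ Finset.range n, f ℓ (i + 1 + t)) ^ 2 ≤
      A ^ 2 * (4 * zetaSum (1 + θ / 2) ^ 2 / (1 - θ) ^ 2) * (n : ℝ) ^ (1 - θ) := by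
  set Y := zetaSum (1 + θ / 2)
  have hs := summable_succ_rpow_neg (by linarith : 1 < 1 + θ / 2)
  set S := ∑ t ∈ Finset.range n, ((t : ℝ) + 1) ^ (-((1 + θ) / 2)) with hS
  have hS0 : 0 ≤ S := Finset.sum_nonneg fun _ _ => by positivity
  have hfin : ∀ i ℓ, |∑ t ∈ Finset.range n, f ℓ (i + 1 + t)| ≤
      A * (((i : ℝ) + 1) ^ (-(1 / 2 + θ / 4)) * ((ℓ : ℝ) + 1) ^ (-(1 / 2 + θ / 4)) * S) := by
    intro i ℓ
    rw [hS, Finset.mul_sum, Finset.mul_sum]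
    refine (Finset.abs_sum_le_sum_abs _ _).trans (Finset.sum_le_sum fun t _ => ?_)
    refine (hf ℓ (i + 1 + t)).trans (mul_le_mul_of_nonneg_left ?_ hA)
    refine le_trans ?_ (decaySeq_window_le hθ0 i t ℓ)
    exact mul_le_mul (decaySeq_anti hθ0 (by omega)) (decaySeq_anti hθ0 (by omega))
      (decaySeq_nonneg _ _) (decaySeq_nonneg _ _)
  have hmid : ∀ i : ℕ, ∑' ℓ : ℕ, (∑ t ∈ Finset.range n, f ℓ (i + 1 + t)) ^ 2 ≤
      A ^ 2 * S ^ 2 * Y * ((i : ℝ) + 1) ^ (-(1 + θ / 2)) := by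
    intro i
    have : A ^ 2 * S ^ 2 * Y * ((i : ℝ) + 1) ^ (-(1 + θ / 2)) =
      A ^ 2 * S ^ 2 * ((i : ℝ) + 1) ^ (-(1 + θ / 2)) * Y := by ring
    rw [this]
    refine tsum_le_mul_tsum (fun _ => sq_nonneg _) (fun ℓ => ?_) hs
    rw [← sq_abs]
    refine (pow_le_pow_left₀ (abs_nonneg _) (hfin i ℓ) 2).trans (le_of_eq ?_)
    rw [← rpow_sq_of_pos (by positivity : (0 : ℝ) < (i : ℝ) + 1)
        (by ring : 2 * (-(1 / 2 + θ / 4)) = -(1 + θ / 2)),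
      ← rpow_sq_of_pos (by positivity : (0 : ℝ) < (ℓ : ℝ) + 1)
        (by ring : 2 * (-(1 / 2 + θ / 4)) = -(1 + θ / 2))]
    ring
  have hSle : S ^ 2 ≤ 4 / (1 - θ) ^ 2 * (n : ℝ) ^ (1 - θ) := by
    have h := sum_range_succ_rpow_neg_le (p := (1 + θ) / 2) (by linarith) (by linarith) n
    refine (pow_le_pow_left₀ hS0 h 2).trans (le_of_eq ?_)
    have hpow : ((n : ℝ) ^ (1 - (1 + θ) / 2)) ^ 2 = (n : ℝ) ^ (1 - θ) := by
      rw [← Real.rpow_mul_natCast (by positivity)]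
      congr 1
      push_cast
      ring
    have hne : 1 - θ ≠ 0 := by linarith
    have h2 : 1 - (1 + θ) / 2 = (1 - θ) / 2 := by ring
    rw [div_pow, hpow, h2]
    field_simp
    norm_num
  calc _ ≤ A ^ 2 * S ^ 2 * Y * Y :=
        tsum_le_mul_tsum (fun _ => tsum_nonneg fun _ => sq_nonneg _) hmid hs
    _ = A ^ 2 * Y ^ 2 * S ^ 2 := by ring
    _ ≤ A ^ 2 * Y ^ 2 * (4 / (1 - θ) ^ 2 * (n : ℝ) ^ (1 - θ)) := by gcongr
    _ = _ := by ring

lemma l1norm_nonneg (d : ℕ) (v : ℕ → ℝ) : 0 ≤ l1norm d v :=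
  Finset.sum_nonneg fun _ _ => abs_nonneg _

lemma abs_sum_mul_le_l1norm {d : ℕ} {v w : ℕ → ℝ} {c : ℕ → ℕ → ℝ} {B : ℝ}
    (hc : ∀ ν < d, ∀ μ < d, |c ν μ| ≤ B) :
    |∑ ν ∈ Finset.range d, ∑ μ ∈ Finset.range d, v ν * w μ * c ν μ| ≤
      l1norm d v * l1norm d w * B := by
  rw [l1norm, l1norm, Finset.sum_mul_sum, Finset.sum_mul]
  refine (Finset.abs_sum_le_sum_abs _ _).trans (Finset.sum_le_sum fun ν hν => ?_)
  rw [Finset.sum_mul]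
  refine (Finset.abs_sum_le_sum_abs _ _).trans (Finset.sum_le_sum fun μ hμ => ?_)
  rw [abs_mul, abs_mul]
  exact mul_le_mul_of_nonneg_left (hc ν (Finset.mem_range.1 hν) μ (Finset.mem_range.1 hμ))
    (by positivity)

lemma abs_fCoef_le {d : ℕ} {a : ℕ → ℕ → ℝ} (v w : ℕ → ℝ) {g : ℕ → ℝ}
    (hg : ∀ j, 0 ≤ g j) (ha : ∀ j ν, ν < d → |a j ν| ≤ g j) (ℓ j : ℕ) :
    |fCoef d a v w ℓ j| ≤ l1norm d v * l1norm d w * (2 * (g j * g (j + ℓ))) := by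
  have hprod : ∀ i k ν μ, ν < d → μ < d → |a i ν * a k μ| ≤ g i * g k := by
    intro i k ν μ hν hμ
    rw [abs_mul]
    exact mul_le_mul (ha i ν hν) (ha k μ hμ) (abs_nonneg _) (hg i)
  unfold fCoef
  split_ifs with h
  · subst h
    refine abs_sum_mul_le_l1norm fun ν hν μ hμ => ?_
    have := hprod j j ν μ hν hμ
    have := mul_nonneg (hg j) (hg j)
    simp only [add_zero]
    linarith
  · refine abs_sum_mul_le_l1norm fun ν hν μ hμ => ?_
    have h1 := hprod j (j + ℓ) ν μ hν hμ
    have h2 := hprod j (j + ℓ) μ ν hμ hν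
    have := abs_add_le (a j ν * a (j + ℓ) μ) (a j μ * a (j + ℓ) ν)
    linarith

lemma rpow_max_one_le_two_mul_decaySeq {θ : ℝ} (hθ0 : 0 < θ) (hθ1 : θ < 1 / 2) (j : ℕ) :
    ((max j 1 : ℕ) : ℝ) ^ (-(3 / 4 : ℝ) - θ / 2) ≤ 2 * decaySeq θ j := by
  have h1 : ((j : ℝ) + 1) / 2 ≤ ((max j 1 : ℕ) : ℝ) := by
    have ha : (j : ℝ) ≤ ((max j 1 : ℕ) : ℝ) := by exact_mod_cast le_max_left j 1
    have hb : (1 : ℝ) ≤ ((max j 1 : ℕ) : ℝ) := by exact_mod_cast le_max_right j 1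
    linarith
  have h2 : ((max j 1 : ℕ) : ℝ) ^ (-(3 / 4 + θ / 2)) ≤ (((j : ℝ) + 1) / 2) ^ (-(3 / 4 + θ / 2)) :=
    Real.rpow_le_rpow_of_nonpos (by positivity) h1 (by linarith)
  have h3 : (2 : ℝ) ^ (3 / 4 + θ / 2) ≤ 2 := by
    conv_rhs => rw [← Real.rpow_one 2]
    exact Real.rpow_le_rpow_of_exponent_le (by norm_num) (by linarith)
  have he : -(3 / 4 : ℝ) - θ / 2 = -(3 / 4 + θ / 2) := by ring
  rw [he]
  refine h2.trans ?_
  rw [Real.div_rpow (by positivity) (by norm_num), Real.rpow_neg (by norm_num : (0 : ℝ) ≤ 2),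
    div_inv_eq_mul, mul_comm]
  exact mul_le_mul_of_nonneg_right h3 (decaySeq_nonneg θ j)

lemma summable_of_decay {θ A : ℝ} (hθ0 : 0 < θ) (hA : 0 ≤ A) {f : ℕ → ℕ → ℝ}
    (hf : ∀ ℓ j, |f ℓ j| ≤ A * (decaySeq θ j * decaySeq θ (j + ℓ))) (ℓ : ℕ) :
    Summable (f ℓ) := by
  refine Summable.of_norm_bounded
    ((summable_succ_rpow_neg (by linarith : 1 < 3 / 2 + θ)).mul_left A) fun j => ?_
  refine (hf ℓ j).trans (mul_le_mul_of_nonneg_left ?_ hA)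
  refine (mul_le_mul_of_nonneg_left (decaySeq_anti hθ0 (Nat.le_add_right j ℓ))
    (decaySeq_nonneg θ j)).trans (le_of_eq ?_)
  rw [← pow_two, decaySeq, rpow_sq_of_pos (by positivity)]
  ring

lemma tsum_shift_sub_tsum_shift {f : ℕ → ℝ} (hf : Summable f) (i n : ℕ) :
    ∑' j, f (i + j) - ∑' j, f (i + n + j) = ∑ t ∈ Finset.range n, f (i + t) := by
  have hs : Summable fun j => f (i + j) := by
    simpa [add_comm] using (summable_nat_add_iff i).2 hf
  rw [← hs.sum_add_tsum_nat_add n, add_sub_assoc]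
  simp [add_comm, add_left_comm]

/-- (square-summability bounds on the coefficients `f̃` under (D)); the
constant does not depend on the coefficient array `𝔞`. -/
theorem fTilde_square_sum_bounds
    (θ : ℝ) (hθ0 : 0 < θ) (hθ1 : θ < 1 / 2) (Cdec : ℝ) :
    ∃ C : ℝ, ∀ (d : ℕ → ℕ) (a : ℕ → ℕ → ℕ → ℝ) (v w : ℕ → ℕ → ℝ),
      (∀ n j ν, ν < d n →
        |a n j ν| ≤ Cdec * ((max j 1 : ℕ) : ℝ) ^ (-(3 / 4 : ℝ) - θ / 2)) →
      ∀ n n' : ℕ, 1 ≤ n → 1 ≤ n' →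
        ((∑' i : ℕ, ∑' ℓ : ℕ,
            (fTilde (d n) (a n) (v n) (w n) ℓ (i + 1) -
              fTilde (d n) (a n) (v n) (w n) ℓ (i + 1 + n')) ^ 2)
          ≤ C * l1norm (d n) (v n) ^ 2 * l1norm (d n) (w n) ^ 2 * (n' : ℝ) ^ ((1 : ℝ) - θ)) ∧
        ((∑ k ∈ Finset.Icc 1 n', ∑' r : ℕ,
            (fTilde (d n) (a n) (v n) (w n) (r + k) 0) ^ 2)
          ≤ C * l1norm (d n) (v n) ^ 2 * l1norm (d n) (w n) ^ 2 * (n' : ℝ) ^ ((1 : ℝ) - θ)) ∧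
        ((∑ k ∈ Finset.Icc 1 n', ∑' ℓ : ℕ,
            (fTilde (d n) (a n) (v n) (w n) ℓ k) ^ 2)
          ≤ C * l1norm (d n) (v n) ^ 2 * l1norm (d n) (w n) ^ 2 * (n' : ℝ) ^ ((1 : ℝ) - θ)) := by
  set c₁ := 4 * zetaSum (1 + θ / 2) ^ 2 / (1 - θ) ^ 2 with hc₁
  set c₂ := zetaSum (1 + θ / 4) ^ 2 * zetaSum (1 + θ / 2) / (1 - θ) with hc₂
  have hY0 := zetaSum_nonneg (1 + θ / 2)
  have h1θ : 0 < 1 - θ := by linarith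
  have hc₁0 : 0 ≤ c₁ := by positivity
  have hc₂0 : 0 ≤ c₂ := by positivity
  refine ⟨(8 * Cdec ^ 2) ^ 2 * (c₁ + c₂), fun d a v w ha n n' _ _ => ?_⟩
  set V := l1norm (d n) (v n)
  set W := l1norm (d n) (w n)
  have hV0 : 0 ≤ V := l1norm_nonneg _ _
  have hW0 : 0 ≤ W := l1norm_nonneg _ _
  set A := V * W * (8 * Cdec ^ 2) with hA
  have hA0 : 0 ≤ A := by positivity
  have hf : ∀ ℓ j, |fCoef (d n) (a n) (v n) (w n) ℓ j| ≤
      A * (decaySeq θ j * decaySeq θ (j + ℓ)) := by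
    intro ℓ j
    have h := abs_fCoef_le (d := d n) (a := a n) (v n) (w n)
      (g := fun j => 2 * |Cdec| * decaySeq θ j)
      (fun j => mul_nonneg (by positivity) (decaySeq_nonneg θ j))
      (fun j ν hν => by
        refine (ha n j ν hν).trans ((mul_le_mul_of_nonneg_right (le_abs_self Cdec)
          (by positivity)).trans ?_)
        refine (mul_le_mul_of_nonneg_left (rpow_max_one_le_two_mul_decaySeq hθ0 hθ1 j)
          (abs_nonneg Cdec)).trans (le_of_eq (by ring))) ℓ j
    refine h.trans (le_of_eq ?_)
    rw [hA, ← sq_abs Cdec]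
    ring
  have hbound : ∀ {x c : ℝ}, c ≤ c₁ + c₂ → x ≤ A ^ 2 * c * (n' : ℝ) ^ (1 - θ) →
      x ≤ (8 * Cdec ^ 2) ^ 2 * (c₁ + c₂) * V ^ 2 * W ^ 2 * (n' : ℝ) ^ (1 - θ) := by
    intro x c hc hx
    calc x ≤ A ^ 2 * c * (n' : ℝ) ^ (1 - θ) := hx
      _ ≤ A ^ 2 * (c₁ + c₂) * (n' : ℝ) ^ (1 - θ) := by gcongr
      _ = _ := by rw [hA]; ring
  refine ⟨hbound (le_add_of_nonneg_right hc₂0) ?_, hbound (le_add_of_nonneg_left hc₁0) ?_,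
    hbound (le_add_of_nonneg_left hc₁0) ?_⟩
  · simp only [fTilde, tsum_shift_sub_tsum_shift (summable_of_decay hθ0 hA0 hf _)]
    exact tsum_tsum_sq_window_le hθ0 hθ1 hA0 hf n'
  · refine sum_tsum_sq_tail_le hθ0 hθ1 hA0 (fun k r j => ?_) n'
    simpa [add_assoc] using hf (r + k) j
  · refine sum_tsum_sq_tail_le hθ0 hθ1 hA0 (fun k r j => ?_) n'
    refine (hf r (k + j)).trans (mul_le_mul_of_nonneg_left ?_ hA0)
    exact mul_le_mul (decaySeq_anti hθ0 (by omega)) (decaySeq_anti hθ0 (by omega))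
      (decaySeq_nonneg _ _) (decaySeq_nonneg _ _)

end
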